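/- Let G and H be connected graphs, let M be a nonempty proper module of G, and let G' be the graph obtained from G by replacing G[M] with H. If |M| = |V(H)| and the minimum number of paths in a partition of G[M] into paths equals the minimum number of paths in a partition of H into paths, then the minimum number of paths in a partition of G' into paths is at most the minimum number of paths in a partition of G into paths. -/

import Mathlib

open SimpleGraph Set

/-- `M` is a module of `G`: every vertex outside `M` is adjacent to all of `M`
or to none of `M`. -/
def SimpleGraph.IsModuleSet {V : Type*} (G : SimpleGraph V) (M : Set V) : Prop :=
  ∀ v ∉ M, (∀ m ∈ M, G.Adj v m) ∨ (∀ m ∈ M, ¬ G.Adj v m)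

/-- The graph obtained from `G` by replacing `G[M]` with `H`: its vertices are
`(V ∖ M) ⊕ V(H)`, with the edges of `G` outside `M`, the edges of `H`, and all
edges between `N_G(M) ∖ M` and `V(H)`. -/
def modularReplacement {V W : Type*} (G : SimpleGraph V) (M : Set V)
    (H : SimpleGraph W) : SimpleGraph ({v : V // v ∉ M} ⊕ W) :=
  SimpleGraph.fromRel (fun x y =>
    match x, y with
    | Sum.inl u, Sum.inl v => G.Adj u.1 v.1
    | Sum.inl u, Sum.inr _ => ∃ m ∈ M, G.Adj u.1 m
    | Sum.inr _, Sum.inl _ => False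
    | Sum.inr u, Sum.inr v => H.Adj u v)

section Invariants

variable {V : Type*} (G : SimpleGraph V)

/-- A dominating set. -/
def IsDomSet (D : Set V) : Prop := ∀ v ∉ D, ∃ u ∈ D, G.Adj v u

/-- A minimum dominating set. -/
def IsMinDomSet (D : Set V) : Prop :=
  IsDomSet G D ∧ ∀ D', IsDomSet G D' → D.ncard ≤ D'.ncard

/-- The domination number. -/
noncomputable def domNum : ℕ := sInf {n | ∃ D, IsDomSet G D ∧ D.ncard = n}

/-- A vertex cover. -/
def IsVCover (C : Set V) : Prop := ∀ ⦃u v⦄, G.Adj u v → u ∈ C ∨ v ∈ C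

/-- A minimum vertex cover. -/
def IsMinVCover (C : Set V) : Prop :=
  IsVCover G C ∧ ∀ C', IsVCover G C' → C.ncard ≤ C'.ncard

/-- The vertex cover number. -/
noncomputable def vcNum : ℕ := sInf {n | ∃ C, IsVCover G C ∧ C.ncard = n}

/-- A connected vertex cover. -/
def IsCVCover (C : Set V) : Prop := IsVCover G C ∧ (G.induce C).Connected

/-- A minimum connected vertex cover. -/
def IsMinCVCover (C : Set V) : Prop :=
  IsCVCover G C ∧ ∀ C', IsCVCover G C' → C.ncard ≤ C'.ncard

/-- The connected vertex cover number. -/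
noncomputable def cvcNum : ℕ := sInf {n | ∃ C, IsCVCover G C ∧ C.ncard = n}

/-- A feedback vertex set: its removal leaves an acyclic graph. -/
def IsFVS (S : Set V) : Prop := (G.induce Sᶜ).IsAcyclic

/-- A minimum feedback vertex set. -/
def IsMinFVS (S : Set V) : Prop :=
  IsFVS G S ∧ ∀ S', IsFVS G S' → S.ncard ≤ S'.ncard

/-- The feedback vertex set number. -/
noncomputable def fvsNum : ℕ := sInf {n | ∃ S, IsFVS G S ∧ S.ncard = n}

/-- An odd cycle transversal: its removal leaves a bipartite graph. -/
def IsOCT (S : Set V) : Prop := (G.induce Sᶜ).Colorable 2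

/-- A minimum odd cycle transversal. -/
def IsMinOCT (S : Set V) : Prop :=
  IsOCT G S ∧ ∀ S', IsOCT G S' → S.ncard ≤ S'.ncard

/-- The odd cycle transversal number. -/
noncomputable def octNum : ℕ := sInf {n | ∃ S, IsOCT G S ∧ S.ncard = n}

/-- An independent set: pairwise non-adjacent vertices. -/
def IsIndepSet' (I : Set V) : Prop := I.Pairwise (fun u v => ¬ G.Adj u v)

/-- A partition of `G` into `k` (vertex-disjoint) paths covering all vertices. -/
def IsPathPartition (k : ℕ) (P : Fin k → (u : V) × (v : V) × G.Walk u v) : Prop :=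
  (∀ i, (P i).2.2.IsPath) ∧
  (∀ i j, i ≠ j → ∀ x, x ∈ (P i).2.2.support → x ∉ (P j).2.2.support) ∧
  (∀ x : V, ∃ i, x ∈ (P i).2.2.support)

/-- The minimum number of paths in a partition of `G` into paths. -/
noncomputable def pathPartitionNum : ℕ :=
  sInf {k | ∃ P : Fin k → (u : V) × (v : V) × G.Walk u v, IsPathPartition G k P}

/-- `G` has a Hamiltonian cycle. -/
def HasHamCycle : Prop := ∃ (v : V) (p : G.Walk v v), p.IsCycle ∧ ∀ u : V, u ∈ p.support

/-- The number of vertices of a longest induced path of `G`. -/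
noncomputable def lipNum : ℕ :=
  sSup {n | ∃ S : Set V, Nonempty (G.induce S ≃g pathGraph n)}

/-- `X` is an induced matching with `k` edges: `X` has `2k` vertices and the
subgraph induced by `X` is `1`-regular. -/
def IsInducedMatching (X : Set V) (k : ℕ) : Prop :=
  X.ncard = 2 * k ∧ ∀ v ∈ X, ∃! u, u ∈ X ∧ G.Adj v u

/-- The maximum number of edges of an induced matching of `G`. -/
noncomputable def imNum : ℕ := sSup {k | ∃ X, IsInducedMatching G X k}

/-- An independent triangle packing with `k` triangles: pairwise disjoint
triangles with no edges of `G` between different triangles. -/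
def IsIndepTrianglePacking (k : ℕ) (f : Fin k → Set V) : Prop :=
  (∀ i, ∃ a b c : V, f i = {a, b, c} ∧ G.Adj a b ∧ G.Adj a c ∧ G.Adj b c) ∧
  (∀ i j, i ≠ j → ∀ u ∈ f i, ∀ v ∈ f j, u ≠ v ∧ ¬ G.Adj u v)

/-- The maximum number of triangles in an independent triangle packing of `G`. -/
noncomputable def itpNum : ℕ :=
  sSup {k | ∃ f : Fin k → Set V, IsIndepTrianglePacking G k f}

/-- `C` is the vertex set of an induced cycle of `G`. -/
def IsCycleSet (C : Set V) : Prop :=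
  3 ≤ C.ncard ∧ (G.induce C).Connected ∧ ∀ v ∈ C, {u | u ∈ C ∧ G.Adj v u}.ncard = 2

/-- An independent cycle packing with `k` cycles: pairwise disjoint induced
cycles with no edges of `G` between different cycles. -/
def IsIndepCyclePacking (k : ℕ) (f : Fin k → Set V) : Prop :=
  (∀ i, IsCycleSet G (f i)) ∧
  (∀ i j, i ≠ j → ∀ u ∈ f i, ∀ v ∈ f j, u ≠ v ∧ ¬ G.Adj u v)

/-- The maximum number of cycles in an independent cycle packing of `G`. -/
noncomputable def icpNum : ℕ :=
  sSup {k | ∃ f : Fin k → Set V, IsIndepCyclePacking G k f}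

end Invariants

/-- `L` lists the supports of pairwise disjoint paths of `G` covering all vertices. -/
structure IsPathListPartition {V : Type*} (G : SimpleGraph V) (L : List (List V)) : Prop where
  ne_nil : ∀ p ∈ L, p ≠ []
  isChain : ∀ p ∈ L, p.IsChain G.Adj
  nodup : L.flatten.Nodup
  mem : ∀ x, x ∈ L.flatten

theorem exists_isPathPartition_iff {V : Type*} (G : SimpleGraph V) (k : ℕ) :
    (∃ P : Fin k → (u : V) × (v : V) × G.Walk u v, IsPathPartition G k P) ↔
      ∃ L, IsPathListPartition G L ∧ L.length = k := by
  constructor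
  · rintro ⟨P, hpath, hdisj, hcov⟩
    refine ⟨List.ofFn fun i => (P i).2.2.support, ⟨?_, ?_, ?_, ?_⟩, by simp⟩
    · intro p hp
      obtain ⟨i, rfl⟩ := List.mem_ofFn.1 hp
      exact (P i).2.2.support_ne_nil
    · intro p hp
      obtain ⟨i, rfl⟩ := List.mem_ofFn.1 hp
      exact (P i).2.2.isChain_adj_support
    · rw [List.nodup_flatten]
      refine ⟨fun p hp => ?_, ?_⟩
      · obtain ⟨i, rfl⟩ := List.mem_ofFn.1 hp
        exact (hpath i).support_nodup
      · exact List.pairwise_ofFn.2 fun i j hij x hx => hdisj i j hij.ne x hx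
    · intro x
      obtain ⟨i, hi⟩ := hcov x
      exact List.mem_flatten.2 ⟨_, List.mem_ofFn.2 ⟨i, rfl⟩, hi⟩
  · rintro ⟨L, hL, rfl⟩
    obtain ⟨hnodup, hdisj⟩ := List.nodup_flatten.1 hL.nodup
    refine ⟨fun i => ⟨_, _, Walk.ofSupport L[i] (hL.ne_nil _ (List.getElem_mem _))
      (hL.isChain _ (List.getElem_mem _))⟩, ?_, ?_, ?_⟩
    · intro i
      refine Walk.IsPath.mk' ?_
      rw [Walk.support_ofSupport]
      exact hnodup _ (List.getElem_mem _)
    · intro i j hij x hxi hxj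
      rw [Walk.support_ofSupport] at hxi hxj
      rcases lt_or_gt_of_ne hij with h | h
      · exact List.pairwise_iff_getElem.1 hdisj i j i.2 j.2 h hxi hxj
      · exact List.pairwise_iff_getElem.1 hdisj j i j.2 i.2 h hxj hxi
    · intro x
      obtain ⟨p, hp, hx⟩ := List.mem_flatten.1 (hL.mem x)
      obtain ⟨i, hi, rfl⟩ := List.getElem_of_mem hp
      refine ⟨⟨i, hi⟩, ?_⟩
      rw [Walk.support_ofSupport]
      exact hx

namespace IsPathListPartition

theorem pathPartitionNum_le {V : Type*} {G : SimpleGraph V} {L : List (List V)}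
    (hL : IsPathListPartition G L) : pathPartitionNum G ≤ L.length :=
  Nat.sInf_le ((exists_isPathPartition_iff G _).2 ⟨L, hL, rfl⟩)

theorem exists_length_eq_pathPartitionNum {V : Type*} [Finite V] (G : SimpleGraph V) :
    ∃ L, IsPathListPartition G L ∧ L.length = pathPartitionNum G := by
  refine (exists_isPathPartition_iff G _).1 (Nat.sInf_mem
    (s := {k | ∃ P : Fin k → (u : V) × (v : V) × G.Walk u v, IsPathPartition G k P}) ?_)
  cases nonempty_fintype V
  refine ⟨_, (exists_isPathPartition_iff G _).2
    ⟨(Finset.univ : Finset V).toList.map fun v => [v], ⟨?_, ?_, ?_, ?_⟩, rfl⟩⟩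
  · simp
  · simp
  · have := (Finset.univ : Finset V).nodup_toList
    simpa [← List.flatMap_def] using this
  · simp [← List.flatMap_def]

theorem length_flatten {V : Type*} [Fintype V] {G : SimpleGraph V} {L : List (List V)}
    (hL : IsPathListPartition G L) : L.flatten.length = Fintype.card V := by
  classical
  rw [← List.toFinset_card_of_nodup hL.nodup, ← Finset.card_univ]
  congr 1
  ext x
  simpa using hL.mem x

theorem length_le_card {V : Type*} [Fintype V] {G : SimpleGraph V} {L : List (List V)}
    (hL : IsPathListPartition G L) : L.length ≤ Fintype.card V := by
  rw [← hL.length_flatten, List.length_flatten]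
  simpa using List.card_nsmul_le_sum (L.map List.length) 1 (by
    simpa [Nat.one_le_iff_ne_zero] using hL.ne_nil)

/-- A path partition can be refined to one with any larger number of paths, up to the number of
vertices. -/
theorem exists_length_eq {V : Type*} [Fintype V] {G : SimpleGraph V} {L : List (List V)}
    (hL : IsPathListPartition G L) {t : ℕ} (ht : L.length ≤ t) (htV : t ≤ Fintype.card V) :
    ∃ L', IsPathListPartition G L' ∧ L'.length = t := by
  induction t, ht using Nat.le_induction with
  | base => exact ⟨L, hL, rfl⟩
  | succ t ht ih =>
    obtain ⟨L', hL', rfl⟩ := ih (by omega)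
    obtain ⟨p, hp, hp2⟩ : ∃ p ∈ L', 2 ≤ p.length := by
      by_contra! h
      have := List.sum_le_card_nsmul (L'.map List.length) 1 (by
        simpa using fun p hp => Nat.le_of_lt_succ (h p hp))
      rw [← List.length_flatten, hL'.length_flatten] at this
      simp at this
      omega
    obtain ⟨a, b, q, rfl⟩ : ∃ a b q, p = a :: b :: q := by
      match p, hp2 with
      | a :: b :: q, _ => exact ⟨a, b, q, rfl⟩
    obtain ⟨A, B, rfl⟩ := List.append_of_mem hp
    obtain ⟨hne, hchain, hnodup, hmem⟩ := hL'
    refine ⟨A ++ [a] :: (b :: q) :: B, ⟨?_, ?_, ?_, ?_⟩, by simp; omega⟩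
    · grind
    · simp only [List.forall_mem_append, List.forall_mem_cons, List.isChain_cons_cons] at hchain ⊢
      exact ⟨hchain.1, .singleton a, hchain.2.1.2, hchain.2.2⟩
    · simpa using hnodup
    · simpa using hmem

end IsPathListPartition

theorem List.nodup_of_nodup_filterMap_sum {α β : Type*} {l : List (α ⊕ β)}
    (hl : (l.filterMap Sum.getLeft?).Nodup) (hr : (l.filterMap Sum.getRight?).Nodup) :
    l.Nodup := by
  induction l with
  | nil => simp
  | cons x l ih =>
    cases x <;> simp_all [List.filterMap_cons]

theorem List.filterMap_getLeft?_map_inr {α β : Type*} (l : List β) :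
    (l.map (Sum.inr : β → α ⊕ β)).filterMap Sum.getLeft? = [] := by
  simp [List.filterMap_map]

theorem List.filterMap_getRight?_map_inr {α β : Type*} (l : List β) :
    (l.map (Sum.inr : β → α ⊕ β)).filterMap Sum.getRight? = l := by
  induction l <;> simp_all

section modularReplacement

variable {V W : Type*} {G : SimpleGraph V} {M : Set V} {H : SimpleGraph W}

theorem modularReplacement_adj_inl_inl {u v : {v : V // v ∉ M}} :
    (modularReplacement G M H).Adj (.inl u) (.inl v) ↔ G.Adj u.1 v.1 := by
  simp only [modularReplacement, SimpleGraph.fromRel_adj, ne_eq, Sum.inl.injEq, G.adj_comm v.1,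
    or_self, and_iff_right_iff_imp]
  rintro h rfl
  exact h.ne rfl

theorem modularReplacement_adj_inr_inr {u v : W} :
    (modularReplacement G M H).Adj (.inr u) (.inr v) ↔ H.Adj u v := by
  simp only [modularReplacement, SimpleGraph.fromRel_adj, ne_eq, Sum.inr.injEq, H.adj_comm v,
    or_self, and_iff_right_iff_imp]
  rintro h rfl
  exact h.ne rfl

theorem modularReplacement_adj_inl_inr {u : {v : V // v ∉ M}} {w : W} :
    (modularReplacement G M H).Adj (.inl u) (.inr w) ↔ ∃ m ∈ M, G.Adj u.1 m := by
  simp [modularReplacement, SimpleGraph.fromRel_adj]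

theorem isChain_map_inr {r : List W} (hr : r.IsChain H.Adj) :
    (r.map Sum.inr).IsChain (modularReplacement G M H).Adj :=
  (List.isChain_map _).2 (hr.imp fun _ _ => modularReplacement_adj_inr_inr.2)

open Classical in
/-- A path of `G` decomposes into its vertices outside `M` and its maximal subpaths inside `M`;
the latter can be exchanged for any sequence of equally many paths of `H`. -/
theorem exists_replace_path (a : V) (p : List V) (hp : (a :: p).IsChain G.Adj) :
    ∃ S : List (List M), (∀ s ∈ S, s ≠ [] ∧ s.IsChain (G.induce M).Adj) ∧
      S.flatten.map Subtype.val = (a :: p).filter (· ∈ M) ∧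
      (∀ ha : a ∈ M, ∃ s S', S = (⟨a, ha⟩ :: s) :: S') ∧
      ∀ R : List (List W), R.length = S.length → (∀ r ∈ R, r ≠ [] ∧ r.IsChain H.Adj) →
        ∃ b q, (b :: q).IsChain (modularReplacement G M H).Adj ∧
          ((b :: q).filterMap Sum.getLeft?).map Subtype.val = (a :: p).filter (· ∉ M) ∧
          (b :: q).filterMap Sum.getRight? = R.flatten ∧
          (∀ ha : a ∉ M, b = .inl ⟨a, ha⟩) ∧ (a ∈ M → ∃ w, b = .inr w) := by
  induction p generalizing a with
  | nil =>
    by_cases ha : a ∈ M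
    · refine ⟨[[⟨a, ha⟩]], by simp, by simp [ha], fun _ => ⟨_, _, rfl⟩, fun R hR hRc => ?_⟩
      obtain ⟨r, rfl⟩ := List.length_eq_one_iff.1 hR
      obtain ⟨hne, hch⟩ := hRc r (by simp)
      obtain ⟨w, r, rfl⟩ := List.exists_cons_of_ne_nil hne
      exact ⟨.inr w, r.map .inr, isChain_map_inr hch,
        by rw [← List.map_cons, List.filterMap_getLeft?_map_inr]; simp [ha],
        by rw [← List.map_cons, List.filterMap_getRight?_map_inr]; simp,
        fun h => absurd ha h, fun _ => ⟨w, rfl⟩⟩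
    · refine ⟨[], by simp, by simp [ha], fun h => absurd h ha, fun R hR _ => ?_⟩
      obtain rfl := List.length_eq_zero_iff.1 hR
      exact ⟨.inl ⟨a, ha⟩, [], by simp, by simp [ha], by simp, fun _ => rfl, fun h => absurd h ha⟩
  | cons c p ih =>
    rw [List.isChain_cons_cons] at hp
    obtain ⟨hac, hp⟩ := hp
    obtain ⟨S, hS, hSM, hSc, hrep⟩ := ih c hp
    by_cases ha : a ∈ M
    · by_cases hc : c ∈ M
      · obtain ⟨s, S, rfl⟩ := hSc hc
        refine ⟨(⟨a, ha⟩ :: ⟨c, hc⟩ :: s) :: S, ?_, ?_, fun _ => ⟨_, _, rfl⟩, fun R hR hRc => ?_⟩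
        · simp only [List.forall_mem_cons] at hS ⊢
          exact ⟨⟨by simp, List.isChain_cons_cons.2 ⟨hac, hS.1.2⟩⟩, hS.2⟩
        · rw [List.filter_cons_of_pos (by simpa using ha), ← hSM]
          simp
        · obtain ⟨b, q, hbq, hl, hr, -, hb⟩ := hrep R hR hRc
          refine ⟨b, q, hbq, ?_, hr, fun h => absurd ha h, fun _ => hb hc⟩
          rw [List.filter_cons_of_neg (by simpa using ha), hl]
      · refine ⟨[⟨a, ha⟩] :: S, ?_, ?_, fun _ => ⟨_, _, rfl⟩, fun R hR hRc => ?_⟩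
        · simpa only [List.forall_mem_cons] using ⟨by simp, hS⟩
        · rw [List.filter_cons_of_pos (by simpa using ha), ← hSM]
          simp
        · match R, hR with
          | r :: R, hR =>
            simp only [List.forall_mem_cons] at hRc
            obtain ⟨b, q, hbq, hl, hr, hb, -⟩ := hrep R (by simpa using hR) hRc.2
            obtain ⟨w, r, rfl⟩ := List.exists_cons_of_ne_nil hRc.1.1
            refine ⟨.inr w, r.map .inr ++ b :: q, ?_, ?_, ?_, fun h => absurd ha h,
              fun _ => ⟨w, rfl⟩⟩
            · rw [← List.cons_append, ← List.map_cons, List.isChain_append]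
              refine ⟨isChain_map_inr hRc.1.2, hbq, fun x hx y hy => ?_⟩
              obtain ⟨x, -, rfl⟩ := List.mem_map.1 (List.mem_of_getLast? hx)
              obtain rfl : b = y := by simpa using hy
              rw [hb hc]
              exact (modularReplacement_adj_inl_inr.2 ⟨a, ha, hac.symm⟩).symm
            · rw [List.filter_cons_of_neg (by simpa using ha), ← hl, ← List.cons_append,
                ← List.map_cons, List.filterMap_append, List.filterMap_getLeft?_map_inr,
                List.nil_append]
            · rw [← List.cons_append, ← List.map_cons, List.filterMap_append,
                List.filterMap_getRight?_map_inr, hr, List.flatten_cons]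
    · refine ⟨S, hS, ?_, fun h => absurd h ha, fun R hR hRc => ?_⟩
      · rw [List.filter_cons_of_neg (by simpa using ha), hSM]
      · obtain ⟨b, q, hbq, hl, hr, hb, hb'⟩ := hrep R hR hRc
        refine ⟨.inl ⟨a, ha⟩, b :: q, List.isChain_cons_cons.2 ⟨?_, hbq⟩, ?_, ?_, fun _ => rfl,
          fun h => absurd h ha⟩
        · by_cases hc : c ∈ M
          · obtain ⟨w, rfl⟩ := hb' hc
            exact modularReplacement_adj_inl_inr.2 ⟨c, hc, hac⟩
          · rw [hb hc]
            exact modularReplacement_adj_inl_inl.2 hac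
        · rw [List.filter_cons_of_pos (by simpa using ha), ← hl]
          simp
        · rw [← hr, List.filterMap_cons_none rfl]

open Classical in
/-- The version of `exists_replace_path` for a sequence of paths. -/
theorem exists_replace_paths (L : List (List V)) (hne : ∀ p ∈ L, p ≠ [])
    (hchain : ∀ p ∈ L, p.IsChain G.Adj) :
    ∃ S : List (List M), (∀ s ∈ S, s ≠ [] ∧ s.IsChain (G.induce M).Adj) ∧
      S.flatten.map Subtype.val = L.flatten.filter (· ∈ M) ∧
      ∀ R : List (List W), R.length = S.length → (∀ r ∈ R, r ≠ [] ∧ r.IsChain H.Adj) →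
        ∃ Q : List (List ({v : V // v ∉ M} ⊕ W)), Q.length = L.length ∧
          (∀ q ∈ Q, q ≠ [] ∧ q.IsChain (modularReplacement G M H).Adj) ∧
          (Q.flatten.filterMap Sum.getLeft?).map Subtype.val = L.flatten.filter (· ∉ M) ∧
          Q.flatten.filterMap Sum.getRight? = R.flatten := by
  induction L with
  | nil =>
    refine ⟨[], by simp, by simp, fun R hR _ => ⟨[], ?_⟩⟩
    obtain rfl := List.length_eq_zero_iff.1 hR
    simp
  | cons p L ih =>
    rw [List.forall_mem_cons] at hne hchain
    obtain ⟨a, p, rfl⟩ := List.exists_cons_of_ne_nil hne.1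
    obtain ⟨S₁, hS₁, hM₁, -, hrep₁⟩ := exists_replace_path (M := M) (H := H) a p hchain.1
    obtain ⟨S₂, hS₂, hM₂, hrep₂⟩ := ih hne.2 hchain.2
    refine ⟨S₁ ++ S₂, List.forall_mem_append.2 ⟨hS₁, hS₂⟩, ?_, fun R hR hRc => ?_⟩
    · rw [List.flatten_append, List.map_append, hM₁, hM₂, List.flatten_cons, List.filter_append]
    · rw [List.length_append] at hR
      obtain ⟨b, q, hbq, hl₁, hr₁, -⟩ := hrep₁ (R.take S₁.length) (by simp; omega)
        fun r hr => hRc r (List.mem_of_mem_take hr)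
      obtain ⟨Q, hlen, hQ, hl₂, hr₂⟩ := hrep₂ (R.drop S₁.length) (by simp; omega)
        fun r hr => hRc r (List.mem_of_mem_drop hr)
      refine ⟨(b :: q) :: Q, by simp [hlen], List.forall_mem_cons.2 ⟨⟨by simp, hbq⟩, hQ⟩, ?_, ?_⟩
      · rw [List.flatten_cons, List.filterMap_append, List.map_append, hl₁, hl₂,
          List.flatten_cons, List.filter_append]
      · rw [List.flatten_cons, List.filterMap_append, hr₁, hr₂, ← List.flatten_append,
          List.take_append_drop]

end modularReplacement

theorem stmt14 {V W : Type*} [Fintype V] [Fintype W]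
    (G : SimpleGraph V) (H : SimpleGraph W) (M : Set V)
    (hG : G.Connected) (hH : H.Connected)
    (hMod : G.IsModuleSet M) (hne : M.Nonempty) (hproper : M ≠ Set.univ)
    (hcard : M.ncard = Fintype.card W)
    (hpip : pathPartitionNum (G.induce M) = pathPartitionNum H) :
    pathPartitionNum (modularReplacement G M H) ≤ pathPartitionNum G := by
  classical
  obtain ⟨L, hL, hlen⟩ := IsPathListPartition.exists_length_eq_pathPartitionNum G
  obtain ⟨R₀, hR₀, hlenR₀⟩ := IsPathListPartition.exists_length_eq_pathPartitionNum H
  obtain ⟨S, hS, hSM, hrep⟩ :=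
    exists_replace_paths (M := M) (H := H) L hL.ne_nil hL.isChain
  have hSpart : IsPathListPartition (G.induce M) S := by
    refine ⟨fun s hs => (hS s hs).1, fun s hs => (hS s hs).2, ?_, fun x => ?_⟩
    · refine List.Nodup.of_map Subtype.val ?_
      rw [hSM]
      exact hL.nodup.filter _
    · rw [← List.mem_map_of_injective Subtype.val_injective, hSM, List.mem_filter]
      exact ⟨hL.mem _, by simp⟩
  have hSle : S.length ≤ Fintype.card W := by
    rw [← hcard, ← Nat.card_coe_set_eq, Nat.card_eq_fintype_card]
    exact hSpart.length_le_card
  obtain ⟨R, hR, hlenR⟩ := hR₀.exists_length_eq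
    (hlenR₀.trans_le (hpip ▸ hSpart.pathPartitionNum_le)) hSle
  obtain ⟨Q, hlenQ, hQ, hl, hr⟩ := hrep R hlenR fun r h => ⟨hR.ne_nil r h, hR.isChain r h⟩
  have hQpart : IsPathListPartition (modularReplacement G M H) Q := by
    refine ⟨fun q hq => (hQ q hq).1, fun q hq => (hQ q hq).2, ?_, ?_⟩
    · refine List.nodup_of_nodup_filterMap_sum (List.Nodup.of_map Subtype.val ?_) ?_
      · rw [hl]
        exact hL.nodup.filter _
      · rw [hr]
        exact hR.nodup
    · rintro (v | w)
      · have hv : v ∈ Q.flatten.filterMap Sum.getLeft? := by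
          rw [← List.mem_map_of_injective Subtype.val_injective, hl, List.mem_filter]
          exact ⟨hL.mem _, by simpa using v.2⟩
        obtain ⟨x, hx, hxv⟩ := List.mem_filterMap.1 hv
        rwa [Sum.getLeft?_eq_some_iff.1 hxv] at hx
      · have hw : w ∈ Q.flatten.filterMap Sum.getRight? := hr ▸ hR.mem w
        obtain ⟨x, hx, hxw⟩ := List.mem_filterMap.1 hw
        rwa [Sum.getRight?_eq_some_iff.1 hxw] at hx
  exact hlen ▸ hlenQ ▸ hQpart.pathPartitionNum_le
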